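/- Let p, q ∈ (1,∞), p' = p/(p−1), r = max{p', q}, r' = r/(r−1), and k ∈ [0,1). Then K_{pq}(k) ≤ (r/q)·K_{r'r}(k^{q/r}); explicitly, ∫₀¹ (1−t^q)^{−1/p}·(1−k^q t^q)^{−1/p'} dt ≤ (r/q)·∫₀¹ (1−t^r)^{−1/r'}·(1−k^q t^r)^{−1/r} dt. -/

import Mathlib

open Real intervalIntegral

/-- The integrand `A ^ (b - 1) * B ^ (-b) = A⁻¹ * (A / B) ^ b` is antitone in `b` when `A ≤ B`. -/
theorem rpow_sub_one_mul_rpow_neg_le {A B m b : ℝ} (hA : 0 < A) (hAB : A ≤ B) (hmb : m ≤ b) :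
    A ^ (b - 1) * B ^ (-b) ≤ A ^ (m - 1) * B ^ (-m) := by
  have hB : 0 < B := hA.trans_le hAB
  have key (c : ℝ) : A ^ (c - 1) * B ^ (-c) = A⁻¹ * (A / B) ^ c := by
    rw [rpow_sub_one hA.ne', rpow_neg hB.le, div_rpow hA.le hB.le]
    ring
  rw [key, key]
  exact mul_le_mul_of_nonneg_left
    (rpow_le_rpow_of_exponent_ge (div_pos hA hB) ((div_le_one hB).2 hAB) hmb) (inv_pos.2 hA).le

theorem image_rpow_Ioo_zero_one {a : ℝ} (ha : 0 < a) :
    (fun u : ℝ => u ^ a) '' Set.Ioo 0 1 = Set.Ioo 0 1 := by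
  ext t
  constructor
  · rintro ⟨u, ⟨hu0, hu1⟩, rfl⟩
    exact ⟨rpow_pos_of_pos hu0 a, rpow_lt_one hu0.le hu1 ha⟩
  · rintro ⟨ht0, ht1⟩
    exact ⟨t ^ a⁻¹, ⟨rpow_pos_of_pos ht0 _, rpow_lt_one ht0.le ht1 (inv_pos.2 ha)⟩,
      rpow_inv_rpow ht0.le ha.ne'⟩

theorem setIntegral_Ioo_zero_one_comp_rpow {a : ℝ} (ha : 0 < a) (g : ℝ → ℝ) :
    ∫ t in Set.Ioo (0 : ℝ) 1, g t = ∫ u in Set.Ioo (0 : ℝ) 1, a * u ^ (a - 1) * g (u ^ a) := by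
  have hinj : Set.InjOn (fun u : ℝ => u ^ a) (Set.Ioo 0 1) := fun x hx y hy h =>
    (rpow_left_inj hx.1.le hy.1.le ha.ne').1 h
  have h := MeasureTheory.integral_image_eq_integral_abs_deriv_smul measurableSet_Ioo
    (fun x hx => (hasDerivAt_rpow_const (p := a) (Or.inl hx.1.ne')).hasDerivWithinAt) hinj g
  rw [image_rpow_Ioo_zero_one ha] at h
  rw [h]
  refine MeasureTheory.setIntegral_congr_fun measurableSet_Ioo fun x hx => ?_
  simp only [smul_eq_mul]
  rw [abs_of_pos (mul_pos ha (rpow_pos_of_pos hx.1 _))]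

theorem integrableOn_one_sub_rpow_mul {m r κ : ℝ} (hm0 : 0 < m) (hm1 : m ≤ 1) (hr : 1 ≤ r)
    (hκ0 : 0 ≤ κ) (hκ1 : κ < 1) :
    MeasureTheory.IntegrableOn (fun t : ℝ => (1 - t ^ r) ^ (m - 1) * (1 - κ * t ^ r) ^ (-m))
      (Set.Ioo 0 1) := by
  have hdom : MeasureTheory.IntegrableOn (fun t : ℝ => (1 - t) ^ (m - 1) * (1 - κ) ^ (-m))
      (Set.Ioo 0 1) := by
    have h := ((intervalIntegrable_rpow' (a := 0) (b := 1)
      (show -1 < m - 1 by linarith)).comp_sub_left 1).symm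
    rw [sub_zero, sub_self, intervalIntegrable_iff_integrableOn_Ioo_of_le zero_le_one] at h
    exact h.mul_const _
  refine hdom.mono' (Measurable.aestronglyMeasurable (by fun_prop)) ?_
  refine (MeasureTheory.ae_restrict_iff' measurableSet_Ioo).2 (.of_forall fun t ht => ?_)
  have hx0 : 0 < t ^ r := rpow_pos_of_pos ht.1 r
  have hxt : t ^ r ≤ t := by
    simpa using rpow_le_rpow_of_exponent_ge ht.1 ht.2.le hr
  have hx1 : t ^ r < 1 := hxt.trans_lt ht.2
  have hB : 1 - κ ≤ 1 - κ * t ^ r := by nlinarith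
  have hκ : 0 < 1 - κ := sub_pos.2 hκ1
  rw [norm_of_nonneg (mul_nonneg (rpow_nonneg (by linarith) _) (rpow_nonneg (by linarith) _))]
  exact mul_le_mul
    (rpow_le_rpow_of_nonpos (by linarith [ht.2]) (by linarith) (by linarith))
    (rpow_le_rpow_of_nonpos hκ hB (by linarith))
    (rpow_nonneg (by linarith) _) (rpow_nonneg (by linarith [ht.2]) _)

theorem stmt13 (p q k r : ℝ) (hp : 1 < p) (hq : 1 < q) (hk0 : 0 ≤ k) (hk1 : k < 1)
    (hr : r = max (p / (p - 1)) q) :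
    (∫ t in (0:ℝ)..1,
        (1 - t ^ q) ^ (-(1 / p)) * (1 - k ^ q * t ^ q) ^ (-(1 / (p / (p - 1)))))
      ≤ r / q *
        ∫ t in (0:ℝ)..1,
          (1 - t ^ r) ^ (-(1 / (r / (r - 1)))) * (1 - k ^ q * t ^ r) ^ (-(1 / r)) := by
  have hq0 : 0 < q := by linarith
  have hqr : q ≤ r := hr ▸ le_max_right _ _
  have hpr : p / (p - 1) ≤ r := hr ▸ le_max_left _ _
  have hr0 : 0 < r := by linarith
  have hp' : 0 < p / (p - 1) := div_pos (by linarith) (by linarith)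
  have hmb : 1 / r ≤ 1 / (p / (p - 1)) := one_div_le_one_div_of_le hp' hpr
  have hexp_p : -(1 / p) = 1 / (p / (p - 1)) - 1 := by
    have : p ≠ 0 := by linarith
    field_simp
    ring
  have hexp_r : -(1 / (r / (r - 1))) = 1 / r - 1 := by
    rw [one_div_div, sub_div, div_self hr0.ne']
    ring
  have hκ0 : 0 ≤ k ^ q := rpow_nonneg hk0 q
  have hκ1 : k ^ q < 1 := rpow_lt_one hk0 hk1 hq0
  have hint := integrableOn_one_sub_rpow_mul (m := 1 / r) (r := r) (by positivity)
    ((div_le_one hr0).2 (by linarith)) (by linarith) hκ0 hκ1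
  rw [hexp_p, hexp_r, integral_of_le zero_le_one, integral_of_le zero_le_one,
    MeasureTheory.integral_Ioc_eq_integral_Ioo, MeasureTheory.integral_Ioc_eq_integral_Ioo,
    setIntegral_Ioo_zero_one_comp_rpow (div_pos hr0 hq0), ← MeasureTheory.integral_const_mul]
  have hbounds {u : ℝ} (hu : u ∈ Set.Ioo (0 : ℝ) 1) :
      0 < 1 - u ^ r ∧ 1 - u ^ r ≤ 1 - k ^ q * u ^ r := by
    have h0 : 0 < u ^ r := rpow_pos_of_pos hu.1 r
    have h1 : u ^ r < 1 := rpow_lt_one hu.1.le hu.2 hr0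
    constructor <;> nlinarith
  have hpow {u : ℝ} (hu : u ∈ Set.Ioo (0 : ℝ) 1) : (u ^ (r / q)) ^ q = u ^ r := by
    rw [← rpow_mul hu.1.le, div_mul_cancel₀ _ hq0.ne']
  refine MeasureTheory.integral_mono_of_nonneg ?_ (hint.const_mul _) ?_ <;>
    refine (MeasureTheory.ae_restrict_iff' measurableSet_Ioo).2 (.of_forall fun u hu => ?_) <;>
    obtain ⟨hA, hAB⟩ := hbounds hu <;>
    have hB := hA.trans_le hAB <;>
    have hu0 := hu.1 <;>
    simp only [hpow hu, Pi.zero_apply]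
  · positivity
  · rw [mul_assoc]
    refine mul_le_mul_of_nonneg_left ?_ (by positivity)
    calc _ ≤ 1 * ((1 - u ^ r) ^ (1 / (p / (p - 1)) - 1)
          * (1 - k ^ q * u ^ r) ^ (-(1 / (p / (p - 1))))) :=
          mul_le_mul_of_nonneg_right
            (rpow_le_one hu0.le hu.2.le (sub_nonneg.2 ((one_le_div hq0).2 hqr))) (by positivity)
      _ ≤ _ := by
          rw [one_mul]
          exact rpow_sub_one_mul_rpow_neg_le hA hAB hmb
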